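/- (Determinant factorization, Eq. (KtoY).) Fix i ∈ {1,…,L} and a generic point λ ∈ ℂ^L. Then det(K_i) = ∏_{k=1}^L a(λ_i − μ_k)^{1−L} · ∏_{k≠i} ( b(λ_k − λ_i)^{L−1} / a(λ_k − λ_i)^{L−1} ) · det(Y_i), and det(K̄_i) = ∏_{k=1}^L a(λ_i − μ_k)^{1−L} · ∏_{k≠i} ( b(λ_k − λ_i)^{L−1} / a(λ_k − λ_i)^{L−1} ) · det(Ȳ_i). -/

import Mathlib

open Finset Function

noncomputable section

/-- A point `λ ∈ ℂ^L` is generic: the `λ_j` are pairwise distinct, `λ_j - λ_k + η ≠ 0`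
for `j ≠ k`, and `λ_j - μ_k + η ≠ 0` for all `j, k`. -/
def Generic {L : ℕ} (η : ℂ) (μ lam : Fin L → ℂ) : Prop :=
  (∀ j k : Fin L, j ≠ k → lam j ≠ lam k) ∧
  (∀ j k : Fin L, j ≠ k → lam j - lam k + η ≠ 0) ∧
  (∀ j k : Fin L, lam j - μ k + η ≠ 0)

/-- The coefficient `ω_{ij}` of (KZE).  Weights: `a x = x + η`, `b x = x`, `c x = η`. -/
def omegaKZE {L : ℕ} (η : ℂ) (μ lam : Fin L → ℂ) (i j : Fin L) : ℂ :=
  η / (lam j - lam i + η) * ((lam i - lam j + η) / (lam i - lam j)) *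
    (∏ k, (lam j - μ k + η) / (lam i - μ k + η)) *
    ∏ k ∈ univ \ {i, j},
      (lam k - lam i) / (lam k - lam i + η) * ((lam k - lam j + η) / (lam k - lam j))

/-- The coefficient `h_i` of (KZE). -/
def hKZE {L : ℕ} (η : ℂ) (μ lam : Fin L → ℂ) (i : Fin L) : ℂ :=
  (∏ k, (lam i - μ k) / (lam i - μ k + η)) *
      ∏ k ∈ univ.erase i, (lam k - lam i) / (lam k - lam i + η) +
    ∑ k, η / (lam i - μ k + η) +
    ∑ k ∈ univ.erase i, η ^ 2 / ((lam k - lam i) * (lam k - lam i + η)) - 1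

/-- The coefficient `ω^{(n)}_{ij}` of the family (KZF) (for `n ≠ i`, `j ≠ i`), the case
`j = n` carrying the special coefficient `ω^{(n)}_{in}`. -/
def omegaFam {L : ℕ} (η : ℂ) (μ lam : Fin L → ℂ) (n i j : Fin L) : ℂ :=
  if j = n then
    η⁻¹ * (∏ k, (lam i - μ k + η)⁻¹) *
      (∏ k ∈ univ \ {i, n}, (lam k - lam i) / (lam k - lam i + η)) *
      ((lam n - lam i) * ∏ k, (lam n - μ k) +
        (lam i - lam n + η) ^ 2 / (lam i - lam n) * (∏ k, (lam n - μ k + η)) *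
          ∏ k ∈ univ \ {i, n}, (lam k - lam n + η) / (lam k - lam n))
  else
    (lam i - lam j + η) / (lam j - lam i) * ((lam n - lam i + η) / (lam n - lam j + η)) *
      (∏ k, (lam j - μ k + η) / (lam i - μ k + η)) *
      (∏ k ∈ univ.erase i, (lam k - lam i) / (lam k - lam i + η)) *
      ∏ k ∈ univ.erase j, (lam k - lam j + η) / (lam k - lam j)

/-- The coefficient `h^{(n)}_i` of the family (KZF), for `n ≠ i`. -/
def hFam {L : ℕ} (η : ℂ) (μ lam : Fin L → ℂ) (n i : Fin L) : ℂ :=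
  ∑ j ∈ univ \ {i, n}, η ^ 2 / ((lam j - lam i) * (lam j - lam i + η)) +
    ∑ j, η / (lam i - μ j + η) - (lam i - lam n + η) / (lam i - lam n) - 1

/-- `ω^{(n)}_{ij}` with the convention `ω^{(i)}_{ij} := ω_{ij}`. -/
def Omega {L : ℕ} (η : ℂ) (μ lam : Fin L → ℂ) (n i j : Fin L) : ℂ :=
  if n = i then omegaKZE η μ lam i j else omegaFam η μ lam n i j

/-- `h^{(n)}_i` with the convention `h^{(i)}_i := h_i`. -/
def Hcoef {L : ℕ} (η : ℂ) (μ lam : Fin L → ℂ) (n i : Fin L) : ℂ :=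
  if n = i then hKZE η μ lam i else hFam η μ lam n i

/-- The `L × L` matrix `K_i`: entry `(n, j)` is `ω^{(n)}_{ij}` for `j ≠ i` and the column
`i` is constant equal to `η` (`= c`). -/
def Kmat {L : ℕ} (η : ℂ) (μ lam : Fin L → ℂ) (i : Fin L) : Matrix (Fin L) (Fin L) ℂ :=
  fun n j => if j = i then η else Omega η μ lam n i j

/-- The `L × L` matrix `K̄_i`: as `K_i` but with column `i` entries `h^{(n)}_i`. -/
def Kbar {L : ℕ} (η : ℂ) (μ lam : Fin L → ℂ) (i : Fin L) : Matrix (Fin L) (Fin L) ℂ :=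
  fun n j => if j = i then Hcoef η μ lam n i else Omega η μ lam n i j

/-- The reduced coefficient `ω̄^{(n)}_{ij}` of Eq. (BW) (for `j ≠ i`), the case `j = n`
carrying the special coefficient `ω̄^{(n)}_{in}`. -/
def omegaBar {L : ℕ} (η : ℂ) (μ lam : Fin L → ℂ) (n i j : Fin L) : ℂ :=
  if j = n then
    (lam n - lam i + η) / η *
      ((∏ k, (lam n - μ k)) -
        ((lam i - lam n + η) / (lam i - lam n)) ^ 2 * (∏ k, (lam n - μ k + η)) *
          ∏ k ∈ univ \ {i, n}, (lam k - lam n + η) / (lam k - lam n))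
  else
    (lam i - lam j + η) / (lam j - lam i) * ((lam n - lam i + η) / (lam n - lam j + η)) *
      (∏ k, (lam j - μ k + η)) *
      ∏ k ∈ univ.erase j, (lam k - lam j + η) / (lam k - lam j)

/-- The matrix `Y_i`: `K_i` with every entry `ω^{(n)}_{ij}` replaced by `ω̄^{(n)}_{ij}`. -/
def Ymat {L : ℕ} (η : ℂ) (μ lam : Fin L → ℂ) (i : Fin L) : Matrix (Fin L) (Fin L) ℂ :=
  fun n j => if j = i then η else omegaBar η μ lam n i j

/-- The matrix `Ȳ_i`: `K̄_i` with every entry `ω^{(n)}_{ij}` replaced by `ω̄^{(n)}_{ij}`. -/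
def Ybar {L : ℕ} (η : ℂ) (μ lam : Fin L → ℂ) (i : Fin L) : Matrix (Fin L) (Fin L) ℂ :=
  fun n j => if j = i then Hcoef η μ lam n i else omegaBar η μ lam n i j

/-- The common factor relating the coefficients `ω^{(n)}_{ij}` to the reduced ones. -/
def reductionFactor {L : ℕ} (η : ℂ) (μ lam : Fin L → ℂ) (i : Fin L) : ℂ :=
  (∏ k, (lam i - μ k + η)⁻¹) * ∏ k ∈ univ.erase i, (lam k - lam i) / (lam k - lam i + η)

lemma prod_erase_eq_mul_prod_sdiff_pair {ι M : Type*} [Fintype ι] [DecidableEq ι] [CommMonoid M]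
    (f : ι → M) {i j : ι} (h : j ≠ i) :
    ∏ k ∈ univ.erase i, f k = f j * ∏ k ∈ univ \ {i, j}, f k := by
  rw [← mul_prod_erase (univ.erase i) f (mem_erase.2 ⟨h, mem_univ j⟩)]
  congr 2
  ext k
  simp [and_comm]

lemma omegaKZE_eq_reductionFactor_mul {L : ℕ} {η : ℂ} {μ lam : Fin L → ℂ}
    (hgen : Generic η μ lam) {i j : Fin L} (hj : j ≠ i) :
    omegaKZE η μ lam i j = reductionFactor η μ lam i * omegaBar η μ lam i i j := by
  have h₁ : lam i - lam j ≠ 0 := sub_ne_zero.2 (hgen.1 _ _ hj.symm)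
  have h₂ : lam j - lam i ≠ 0 := sub_ne_zero.2 (hgen.1 _ _ hj)
  have h₃ := hgen.2.1 _ _ hj
  have h₄ := hgen.2.1 _ _ hj.symm
  rw [omegaKZE, reductionFactor, omegaBar, if_neg hj, prod_erase_eq_mul_prod_sdiff_pair _ hj,
    prod_erase_eq_mul_prod_sdiff_pair _ hj.symm, pair_comm j i, prod_mul_distrib]
  simp only [div_eq_mul_inv (_ - μ _ + η), prod_mul_distrib (s := univ)]
  generalize ∏ k ∈ univ \ {i, j}, (lam k - lam i) / (lam k - lam i + η) = p
  generalize ∏ k ∈ univ \ {i, j}, (lam k - lam j + η) / (lam k - lam j) = q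
  generalize ∏ k, (lam i - μ k + η)⁻¹ = r
  field_simp
  ring

lemma omegaFam_eq_reductionFactor_mul {L : ℕ} {η : ℂ} {μ lam : Fin L → ℂ}
    (hgen : Generic η μ lam) {n i : Fin L} (hn : n ≠ i) (j : Fin L) :
    omegaFam η μ lam n i j = reductionFactor η μ lam i * omegaBar η μ lam n i j := by
  by_cases hj : j = n
  · have h₁ : lam i - lam n ≠ 0 := sub_ne_zero.2 (hgen.1 _ _ hn.symm)
    have h₂ := hgen.2.1 _ _ hn
    rw [omegaFam, reductionFactor, omegaBar, if_pos hj, if_pos hj,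
      prod_erase_eq_mul_prod_sdiff_pair _ hn]
    generalize ∏ k ∈ univ \ {i, n}, (lam k - lam i) / (lam k - lam i + η) = p
    generalize ∏ k ∈ univ \ {i, n}, (lam k - lam n + η) / (lam k - lam n) = q
    generalize ∏ k, (lam i - μ k + η)⁻¹ = r
    field_simp
    ring
  · rw [omegaFam, reductionFactor, omegaBar, if_neg hj, if_neg hj]
    simp only [div_eq_mul_inv (_ - μ _ + η), prod_mul_distrib (s := univ)]
    ring

lemma Omega_eq_reductionFactor_mul {L : ℕ} {η : ℂ} {μ lam : Fin L → ℂ}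
    (hgen : Generic η μ lam) (n : Fin L) {i j : Fin L} (hj : j ≠ i) :
    Omega η μ lam n i j = reductionFactor η μ lam i * omegaBar η μ lam n i j := by
  by_cases hn : n = i
  · subst hn
    rw [Omega, if_pos rfl, omegaKZE_eq_reductionFactor_mul hgen hj]
  · rw [Omega, if_neg hn, omegaFam_eq_reductionFactor_mul hgen hn]

lemma reductionFactor_pow {L : ℕ} (η : ℂ) (μ lam : Fin L → ℂ) (i : Fin L) (m : ℕ) :
    reductionFactor η μ lam i ^ m =
      (∏ k, ((lam i - μ k + η) ^ m)⁻¹) *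
        ∏ k ∈ univ.erase i, (lam k - lam i) ^ m / (lam k - lam i + η) ^ m := by
  simp only [reductionFactor, mul_pow, ← prod_pow, inv_pow, div_pow]

lemma det_eq_pow_mul_det_of_columns {L : ℕ} {R : Type*} [CommRing R] (c : R) (i : Fin L)
    {A B : Matrix (Fin L) (Fin L) R} (hi : ∀ n, A n i = B n i)
    (h : ∀ n j, j ≠ i → A n j = c * B n j) : A.det = c ^ (L - 1) * B.det := by
  have hA : A = Matrix.of fun n j => (if j = i then 1 else c) * B n j := by
    ext n j
    by_cases hj : j = i
    · simp [hj, hi]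
    · simp [hj, h n j hj]
  have hc : ∏ j, (if j = i then 1 else c) = c ^ (L - 1) := by
    rw [← mul_prod_erase univ _ (mem_univ i), if_pos rfl, one_mul,
      prod_congr rfl fun j hj => if_neg (ne_of_mem_erase hj), prod_const,
      card_erase_of_mem (mem_univ i), card_univ, Fintype.card_fin]
  rw [hA, Matrix.det_mul_row, hc]

/-- determinant factorization, Eq. (KtoY):
`det K_i = ∏_k a(λ_i - μ_k)^{1-L} · ∏_{k≠i} b(λ_k - λ_i)^{L-1}/a(λ_k - λ_i)^{L-1} · det Y_i`
and likewise `det K̄_i = (same prefactor) · det Ȳ_i`. -/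
theorem det_K_factorization {L : ℕ} (hL : 2 ≤ L) (η : ℂ) (hη : η ≠ 0) (μ : Fin L → ℂ)
    (lam : Fin L → ℂ) (hgen : Generic η μ lam) (i : Fin L) :
    (Kmat η μ lam i).det =
        (∏ k, ((lam i - μ k + η) ^ (L - 1))⁻¹) *
          (∏ k ∈ univ.erase i, (lam k - lam i) ^ (L - 1) / (lam k - lam i + η) ^ (L - 1)) *
          (Ymat η μ lam i).det ∧
      (Kbar η μ lam i).det =
        (∏ k, ((lam i - μ k + η) ^ (L - 1))⁻¹) *
          (∏ k ∈ univ.erase i, (lam k - lam i) ^ (L - 1) / (lam k - lam i + η) ^ (L - 1)) *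
          (Ybar η μ lam i).det := by
  rw [← reductionFactor_pow]
  constructor <;> refine det_eq_pow_mul_det_of_columns _ i (fun n => ?_) fun n j hj => ?_
  · simp [Kmat, Ymat]
  · simpa [Kmat, Ymat, hj] using Omega_eq_reductionFactor_mul hgen n hj
  · simp [Kbar, Ybar]
  · simpa [Kbar, Ybar, hj] using Omega_eq_reductionFactor_mul hgen n hj
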